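/- Let E_1, E_2, … be nonnegative real numbers and c > 1. For each n, let A_n be the number of Roberts–Shiryaev alarms among the first n indices (A_n := max{ k : σ_k ≤ n } for the Roberts–Shiryaev stopping times σ_k) and let A'_n be the number of MUSUC alarms among the first n indices (A'_n := max{ k : σ'_k ≤ n } for the MUSUC stopping times σ'_k). Then A'_n ≤ A_n for every n. -/

import Mathlib

/-- Given values `E_1, E_2, …` (represented by `E 0, E 1, …`), the first time
`n > s` such that `∑_{i=s+1}^{n} E_{s+1} ⋯ E_i ≥ c`, as an element of `ℕ∞` (so `⊤ = min ∅`). -/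
noncomputable def nextRS (E : ℕ → ℝ) (c : ℝ) (s : ℕ) : ℕ∞ :=
  sInf {n : ℕ∞ | ∃ m : ℕ, n = m ∧ s < m ∧
    c ≤ ∑ i ∈ Finset.Ico s m, ∏ j ∈ Finset.Icc s i, E j}

/-- The Roberts–Shiryaev stopping times `σ_0 := 0`,
`σ_k := min{ n > σ_{k-1} : ∑_{i=σ_{k-1}+1}^{n} E_{σ_{k-1}+1} ⋯ E_i ≥ c }` (`min ∅ := ∞`),
for the values `E_1, E_2, …` represented by `E 0, E 1, …`. -/
noncomputable def sigmaRS (E : ℕ → ℝ) (c : ℝ) : ℕ → ℕ∞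
  | 0 => 0
  | k + 1 => WithTop.recTopCoe ⊤ (nextRS E c) (sigmaRS E c k)

/-- Given values `E_1, E_2, …` (represented by `E 0, E 1, …`), the first time
`n > s` such that `E_{s+1} ⋯ E_n ≥ c`, as an element of `ℕ∞` (so `⊤ = min ∅`). -/
noncomputable def nextMU (E : ℕ → ℝ) (c : ℝ) (s : ℕ) : ℕ∞ :=
  sInf {n : ℕ∞ | ∃ m : ℕ, n = m ∧ s < m ∧ c ≤ ∏ j ∈ Finset.Ico s m, E j}

/-- The MUSUC stopping times `σ'_0 := 0`,
`σ'_k := min{ n > σ'_{k-1} : E_{σ'_{k-1}+1} ⋯ E_n ≥ c }` (`min ∅ := ∞`),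
for the values `E_1, E_2, …` represented by `E 0, E 1, …`. -/
noncomputable def sigmaMU (E : ℕ → ℝ) (c : ℝ) : ℕ → ℕ∞
  | 0 => 0
  | k + 1 => WithTop.recTopCoe ⊤ (nextMU E c) (sigmaMU E c k)

theorem lt_and_le_prod_of_nextMU_eq {E : ℕ → ℝ} {c : ℝ} {s m : ℕ} (h : nextMU E c s = m) :
    s < m ∧ c ≤ ∏ j ∈ Finset.Ico s m, E j := by
  have hne : {n : ℕ∞ | ∃ m : ℕ, n = m ∧ s < m ∧ c ≤ ∏ j ∈ Finset.Ico s m, E j}.Nonempty := by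
    by_contra hempty
    rw [Set.not_nonempty_iff_eq_empty] at hempty
    simp [nextMU, hempty] at h
  obtain ⟨k, hk, hsk, hck⟩ := csInf_mem hne
  obtain rfl : m = k := by exact_mod_cast h.symm.trans hk
  exact ⟨hsk, hck⟩

theorem prod_lt_of_lt_nextMU {E : ℕ → ℝ} {c : ℝ} {s t : ℕ} (hst : s < t)
    (ht : (t : ℕ∞) < nextMU E c s) : ∏ j ∈ Finset.Ico s t, E j < c := by
  by_contra! h
  exact ht.not_ge (sInf_le ⟨t, rfl, hst, h⟩)

theorem exists_sigmaMU_eq_of_succ {E : ℕ → ℝ} {c : ℝ} {k m : ℕ} (h : sigmaMU E c (k + 1) = m) :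
    ∃ s : ℕ, sigmaMU E c k = s ∧ nextMU E c s = m := by
  cases hs : sigmaMU E c k with
  | top =>
    rw [sigmaMU, hs] at h
    exact absurd h.symm (ENat.natCast_ne_top m)
  | coe s =>
    rw [sigmaMU, hs] at h
    exact ⟨s, rfl, h⟩

/-- The product of the values from any time up to a later MUSUC alarm is at least `1`. -/
theorem one_le_prod_Ico_sigmaMU {E : ℕ → ℝ} (hE : ∀ i, 0 ≤ E i) {c : ℝ} (hc : 1 < c) {k m s : ℕ}
    (hm : sigmaMU E c k = m) (hs : s ≤ m) : 1 ≤ ∏ j ∈ Finset.Ico s m, E j := by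
  induction k generalizing m with
  | zero =>
    obtain rfl : m = 0 := by
      rw [sigmaMU] at hm
      exact_mod_cast hm.symm
    simp
  | succ k ih =>
    obtain ⟨t, ht, htm⟩ := exists_sigmaMU_eq_of_succ hm
    obtain ⟨hlt, hcm⟩ := lt_and_le_prod_of_nextMU_eq htm
    rcases le_or_gt s t with hst | hts
    · rw [← Finset.prod_Ico_consecutive E hst hlt.le]
      exact one_le_mul_of_one_le_of_one_le (ih ht hst) (hc.le.trans hcm)
    · rcases hs.eq_or_lt with rfl | hsm
      · simp
      have hlt_c : ∏ j ∈ Finset.Ico t s, E j < c :=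
        prod_lt_of_lt_nextMU hts (by rw [htm]; exact_mod_cast hsm)
      rw [← Finset.prod_Ico_consecutive E hts.le hs] at hcm
      have h0 : 0 ≤ ∏ j ∈ Finset.Ico t s, E j := Finset.prod_nonneg fun i _ => hE i
      by_contra! hlt_one
      nlinarith

theorem nextRS_le_of_le_prod {E : ℕ → ℝ} (hE : ∀ i, 0 ≤ E i) {c : ℝ} {s m : ℕ} (hsm : s < m)
    (h : c ≤ ∏ j ∈ Finset.Ico s m, E j) : nextRS E c s ≤ m := by
  refine sInf_le ⟨m, rfl, hsm, h.trans ?_⟩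
  obtain ⟨l, rfl⟩ : ∃ l, m = l + 1 := ⟨m - 1, by omega⟩
  have hIco : Finset.Ico s (l + 1) = Finset.Icc s l := by
    ext i
    simp
  rw [hIco]
  exact Finset.single_le_sum (f := fun i => ∏ j ∈ Finset.Icc s i, E j)
    (fun i _ => Finset.prod_nonneg fun j _ => hE j) (Finset.mem_Icc.2 ⟨by omega, le_rfl⟩)

theorem sigmaRS_le_sigmaMU {E : ℕ → ℝ} (hE : ∀ i, 0 ≤ E i) {c : ℝ} (hc : 1 < c) (k : ℕ) :
    sigmaRS E c k ≤ sigmaMU E c k := by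
  induction k with
  | zero => simp [sigmaRS, sigmaMU]
  | succ k ih =>
    cases hm : sigmaMU E c (k + 1) with
    | top => exact le_top
    | coe m =>
      obtain ⟨t, ht, htm⟩ := exists_sigmaMU_eq_of_succ hm
      obtain ⟨hlt, hcm⟩ := lt_and_le_prod_of_nextMU_eq htm
      rw [ht] at ih
      obtain ⟨s, hs⟩ := ENat.ne_top_iff_exists.1 (ne_top_of_le_ne_top (ENat.natCast_ne_top t) ih)
      have hst : s ≤ t := by
        rw [← hs] at ih
        exact_mod_cast ih
      rw [sigmaRS, ← hs]
      refine nextRS_le_of_le_prod hE (hst.trans_lt hlt) ?_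
      rw [← Finset.prod_Ico_consecutive E hst hlt.le]
      exact hcm.trans (le_mul_of_one_le_left (by linarith) (one_le_prod_Ico_sigmaMU hE hc ht hst))

theorem natCast_le_sigmaRS (E : ℕ → ℝ) (c : ℝ) (k : ℕ) : (k : ℕ∞) ≤ sigmaRS E c k := by
  induction k with
  | zero => simp
  | succ k ih =>
    rw [sigmaRS]
    cases hs : sigmaRS E c k with
    | top => exact le_top
    | coe s =>
      rw [hs] at ih
      have hks : k ≤ s := by exact_mod_cast ih
      refine le_sInf ?_
      rintro _ ⟨m, rfl, hsm, -⟩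
      exact_mod_cast (by omega : k + 1 ≤ m)

/-- **MUSUC raises no more alarms than Roberts–Shiryaev.** For nonnegative `E_1, E_2, …`
and `c > 1`, the alarm counts `A_n := max{ k : σ_k ≤ n }` (Roberts–Shiryaev) and
`A'_n := max{ k : σ'_k ≤ n }` (MUSUC) satisfy `A'_n ≤ A_n` for every `n`. -/
theorem alarms_MU_le_alarms_RS (E : ℕ → ℝ) (hE : ∀ i, 0 ≤ E i) (c : ℝ) (hc : 1 < c) (n : ℕ) :
    sSup {k : ℕ | sigmaMU E c k ≤ (n : ℕ∞)} ≤ sSup {k : ℕ | sigmaRS E c k ≤ (n : ℕ∞)} := by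
  refine csSup_le_csSup' ⟨n, fun k hk => ?_⟩ fun k hk => (sigmaRS_le_sigmaMU hE hc k).trans hk
  exact_mod_cast (natCast_le_sigmaRS E c k).trans hk
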